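/- arXiv:1303.0126 — 3 statements merged into one kernel-verified Lean document; each statement's English description precedes it below -/
import Mathlib

section
/- Let $\lambda > 0$, let $\psi, \rho_0 : \mathbb{R}^n \to \mathbb{R}$ be positive $C^1$ functions, and let $f, A : \mathbb{R}^n \to \mathbb{R}^n$ be continuous vector fields. Define the control $u := -\lambda A + \nabla(\ln\psi)$, the controlled density $\rho_u := \psi^2\rho_0$, the uncontrolled current $J_0 := -\tfrac12\nabla\rho_0 + \rho_0 f$, and the controlled current $J_u := -\tfrac12\nabla\rho_u + \rho_u(f + u)$. Then $J_u = \psi^2\,(J_0 - \lambda\rho_0 A)$ pointwise on $\mathbb{R}^n$; consequently $J_u$ vanishes identically if and only if $J_0 = \lambda\rho_0 A$ identically. (This is the key identity in the proof of Proposition 5.10 of the paper, establishing the equivalence of symmetrizability of the optimally controlled diffusion with density $\psi^2\rho_0$ and the condition $J_0 = \lambda\rho_0 A$.) -/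
open Real MeasureTheory

noncomputable section

/-- Partial derivative of a scalar function in the `i`-th coordinate direction. -/
def pd {n : ℕ} (i : Fin n) (h : (Fin n → ℝ) → ℝ) (x : Fin n → ℝ) : ℝ :=
  fderiv ℝ h x (Pi.single i 1)

/-- Gradient of a scalar function on `ℝⁿ`. -/
def grd {n : ℕ} (h : (Fin n → ℝ) → ℝ) (x : Fin n → ℝ) : Fin n → ℝ :=
  fun i => pd i h x

/-- Divergence of a vector field on `ℝⁿ`. -/
def dvg {n : ℕ} (v : (Fin n → ℝ) → (Fin n → ℝ)) (x : Fin n → ℝ) : ℝ :=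
  ∑ i, pd i (fun y => v y i) x

/-- Laplacian of a scalar function on `ℝⁿ`. -/
def lap {n : ℕ} (h : (Fin n → ℝ) → ℝ) : (Fin n → ℝ) → ℝ :=
  dvg (grd h)

/-- Euclidean inner product on `ℝⁿ`. -/
def dot {n : ℕ} (a b : Fin n → ℝ) : ℝ := ∑ i, a i * b i

/-- Key identity in the proof of Proposition 5.10: `J_u = ψ² (J₀ - λρ₀A)`, hence
`J_u = 0` iff `J₀ = λρ₀A`. -/
theorem controlled_current_identity {n : ℕ} (hn : 1 ≤ n) (lam : ℝ) (hlam : 0 < lam)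
    (ψ ρ₀ : (Fin n → ℝ) → ℝ) (hψ : ContDiff ℝ 1 ψ) (hρ₀ : ContDiff ℝ 1 ρ₀)
    (hψpos : ∀ x, 0 < ψ x) (hρ₀pos : ∀ x, 0 < ρ₀ x)
    (f A : (Fin n → ℝ) → (Fin n → ℝ)) (hf : Continuous f) (hA : Continuous A)
    (u : (Fin n → ℝ) → (Fin n → ℝ))
    (hu : u = fun x i => -lam * A x i + grd (fun y => Real.log (ψ y)) x i)
    (ρu : (Fin n → ℝ) → ℝ) (hρu : ρu = fun x => ψ x ^ 2 * ρ₀ x)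
    (J₀ : (Fin n → ℝ) → (Fin n → ℝ))
    (hJ₀ : J₀ = fun x i => -(1 / 2) * grd ρ₀ x i + ρ₀ x * f x i)
    (Ju : (Fin n → ℝ) → (Fin n → ℝ))
    (hJu : Ju = fun x i => -(1 / 2) * grd ρu x i + ρu x * (f x i + u x i)) :
    (∀ x i, Ju x i = ψ x ^ 2 * (J₀ x i - lam * ρ₀ x * A x i)) ∧
    ((∀ x i, Ju x i = 0) ↔ ∀ x i, J₀ x i = lam * ρ₀ x * A x i) := by
  have key : ∀ x i, Ju x i = ψ x ^ 2 * (J₀ x i - lam * ρ₀ x * A x i) := by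
    intro x i
    have h1 : HasFDerivAt ψ (fderiv ℝ ψ x) x :=
      (hψ.differentiable one_ne_zero x).hasFDerivAt
    have h2 : HasFDerivAt ρ₀ (fderiv ℝ ρ₀ x) x :=
      (hρ₀.differentiable one_ne_zero x).hasFDerivAt
    have hp := (hψpos x).ne'
    have h3 := (h1.log hp).fderiv
    have h4 := ((h1.pow 2).mul h2).fderiv
    have h5 : grd (fun y => Real.log (ψ y)) x i = (ψ x)⁻¹ * grd ψ x i := by
      simp only [grd, pd]
      rw [h3]
      simp
    have h6 : grd (fun x => ψ x ^ 2 * ρ₀ x) x i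
        = ψ x ^ 2 * grd ρ₀ x i + ρ₀ x * (2 * ψ x * grd ψ x i) := by
      simp only [grd, pd]
      change (fderiv ℝ ((fun x => ψ x ^ 2) * ρ₀) x) _ = _
      erw [h4]
      simp
    subst hJu hJ₀ hu hρu
    simp only [h5, h6]
    field_simp
    ring
  refine ⟨key, ?_⟩
  constructor
  · intro h x i
    have h1 := key x i
    rw [h x i] at h1
    have h2 : ψ x ^ 2 ≠ 0 := pow_ne_zero 2 (hψpos x).ne'
    have h3 := (mul_eq_zero.mp h1.symm).resolve_left h2
    linarith
  · intro h x i
    rw [key x i, h x i]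
    ring
end
end

section
/- Let $\lambda > 0$, let $f : \mathbb{R}^n \to \mathbb{R}^n$ be a continuous vector field, let $V : \mathbb{R}^n \to \mathbb{R}$ be continuous, and let $\mu \in \mathbb{R}$. For a $C^1$ vector field $B : \mathbb{R}^n \to \mathbb{R}^n$ define the operator $H_B\chi := \tfrac12\Delta\chi + \langle f - \lambda B, \nabla\chi\rangle - W_B\,\chi$ acting on $C^2$ functions $\chi$, where $W_B := \lambda V + \lambda\langle f, B\rangle - \tfrac{\lambda^2}{2}\|B\|^2 + \tfrac{\lambda}{2}\operatorname{div} B$. Suppose $\psi : \mathbb{R}^n \to \mathbb{R}$ is $C^2$, $A$ is a $C^1$ vector field, and $H_A\psi = \mu\psi$ on $\mathbb{R}^n$. Then for every $C^2$ function $\varphi : \mathbb{R}^n \to \mathbb{R}$, the function $\psi_\varphi := e^{\lambda\varphi}\psi$ satisfies $H_{A + \nabla\varphi}\,\psi_\varphi = \mu\,\psi_\varphi$ on $\mathbb{R}^n$. (This is the gauge invariance of the linearized HJB eigenvalue problem, Section 5.4 of the paper: the solution depends only on the equivalence class of the gauge field $A$ modulo exact forms, with $\psi_\varphi = \exp(\lambda\varphi)\psi$.)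 -/
open Real MeasureTheory

noncomputable section

theorem pd_mul_aux {n : ℕ} (i : Fin n) (g h : (Fin n → ℝ) → ℝ) (x : Fin n → ℝ)
    (hg : DifferentiableAt ℝ g x) (hh : DifferentiableAt ℝ h x) :
    pd i (fun y => g y * h y) x = g x * pd i h x + h x * pd i g x := by
  unfold pd
  rw [fderiv_fun_mul hg hh]
  simp

theorem pd_add_aux {n : ℕ} (i : Fin n) (g h : (Fin n → ℝ) → ℝ) (x : Fin n → ℝ)
    (hg : DifferentiableAt ℝ g x) (hh : DifferentiableAt ℝ h x) :
    pd i (fun y => g y + h y) x = pd i g x + pd i h x := by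
  unfold pd
  rw [fderiv_fun_add hg hh]
  simp

theorem pd_exp_aux {n : ℕ} (i : Fin n) (c : ℝ) (g : (Fin n → ℝ) → ℝ) (x : Fin n → ℝ)
    (hg : DifferentiableAt ℝ g x) :
    pd i (fun y => Real.exp (c * g y)) x = Real.exp (c * g x) * (c * pd i g x) := by
  unfold pd
  rw [fderiv_exp (hg.const_mul c), fderiv_const_mul hg]
  simp

theorem pd_diff_aux {n : ℕ} (i : Fin n) (g : (Fin n → ℝ) → ℝ) (hg : ContDiff ℝ 2 g) :
    Differentiable ℝ (pd i g) := by
  have h : ContDiff ℝ 1 (fderiv ℝ g) := hg.fderiv_right (by norm_num)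
  have h2 : Differentiable ℝ (fderiv ℝ g) := h.differentiable (by norm_num)
  unfold pd
  fun_prop

theorem sum_aux {n : ℕ} (E p c l : ℝ) (L D F Q G L' D' F' Q' G' : Fin n → ℝ)
    (h : ∀ i, (1 / 2) * L i + D i - (l * F i - l ^ 2 / 2 * Q i + l / 2 * G i) * (E * p)
      = E * ((1 / 2) * L' i + D' i - (l * F' i - l ^ 2 / 2 * Q' i + l / 2 * G' i) * p)) :
    (1 / 2) * ∑ i, L i + ∑ i, D i
        - (c + l * ∑ i, F i - l ^ 2 / 2 * ∑ i, Q i + l / 2 * ∑ i, G i) * (E * p)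
      = E * ((1 / 2) * ∑ i, L' i + ∑ i, D' i
        - (c + l * ∑ i, F' i - l ^ 2 / 2 * ∑ i, Q' i + l / 2 * ∑ i, G' i) * p) := by
  have hs := Finset.sum_congr (rfl : (Finset.univ : Finset (Fin n)) = _) (fun i _ => h i)
  simp only [Finset.sum_add_distrib, Finset.sum_sub_distrib, ← Finset.mul_sum,
    ← Finset.sum_mul] at hs
  linear_combination hs

/-- Gauge invariance of the linearized HJB eigenvalue problem (Section 5.4):
if `H_A ψ = μψ` then `H_{A+∇φ}(e^{λφ}ψ) = μ e^{λφ}ψ`. -/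
theorem gauge_invariance_linear_hjb {n : ℕ} (hn : 1 ≤ n) (lam : ℝ) (hlam : 0 < lam)
    (f : (Fin n → ℝ) → (Fin n → ℝ)) (hf : Continuous f)
    (V : (Fin n → ℝ) → ℝ) (hV : Continuous V) (μ : ℝ)
    (ψ : (Fin n → ℝ) → ℝ) (hψ : ContDiff ℝ 2 ψ)
    (A : (Fin n → ℝ) → (Fin n → ℝ)) (hA : ContDiff ℝ 1 A)
    (heig : ∀ x, (1 / 2) * lap ψ x
        + dot (fun i => f x i - lam * A x i) (grd ψ x)
        - (lam * V x + lam * dot (f x) (A x) - lam ^ 2 / 2 * dot (A x) (A x)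
            + lam / 2 * dvg A x) * ψ x
        = μ * ψ x)
    (φ : (Fin n → ℝ) → ℝ) (hφ : ContDiff ℝ 2 φ) :
    ∀ x, (1 / 2) * lap (fun y => Real.exp (lam * φ y) * ψ y) x
        + dot (fun i => f x i - lam * (A x i + grd φ x i))
            (grd (fun y => Real.exp (lam * φ y) * ψ y) x)
        - (lam * V x + lam * dot (f x) (fun i => A x i + grd φ x i)
            - lam ^ 2 / 2 * dot (fun i => A x i + grd φ x i) (fun i => A x i + grd φ x i)
            + lam / 2 * dvg (fun y i => A y i + grd φ y i) x)
          * (Real.exp (lam * φ x) * ψ x)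
        = μ * (Real.exp (lam * φ x) * ψ x) := by
  intro x
  have dφ : Differentiable ℝ φ := hφ.differentiable (by norm_num)
  have dψ : Differentiable ℝ ψ := hψ.differentiable (by norm_num)
  have dA : Differentiable ℝ A := hA.differentiable (by norm_num)
  have dAi : ∀ i, Differentiable ℝ (fun y => A y i) := fun i => by fun_prop
  have dE : Differentiable ℝ (fun y => Real.exp (lam * φ y)) := by fun_prop
  have dpφ : ∀ i, Differentiable ℝ (pd i φ) := fun i => pd_diff_aux i φ hφ
  have dpψ : ∀ i, Differentiable ℝ (pd i ψ) := fun i => pd_diff_aux i ψ hψ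
  have h1 : ∀ i, pd i (fun y => Real.exp (lam * φ y) * ψ y)
      = fun y => Real.exp (lam * φ y) * (pd i ψ y + ψ y * (lam * pd i φ y)) := by
    intro i
    funext y
    rw [pd_mul_aux i _ _ y (dE y) (dψ y), pd_exp_aux i lam φ y (dφ y)]
    ring
  have h2 : ∀ i, pd i (fun y => Real.exp (lam * φ y) * (pd i ψ y + ψ y * (lam * pd i φ y))) x
      = Real.exp (lam * φ x) * (pd i (pd i ψ) x + 2 * lam * pd i φ x * pd i ψ x
        + lam * ψ x * pd i (pd i φ) x + lam ^ 2 * (pd i φ x) ^ 2 * ψ x) := by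
    intro i
    have dl : Differentiable ℝ (fun y => lam * pd i φ y) := (dpφ i).const_mul lam
    have e1 : pd i (fun y => lam * pd i φ y) x = lam * pd i (pd i φ) x := by
      have e2 := fderiv_const_mul (dpφ i x) lam
      change fderiv ℝ (fun y => lam * pd i φ y) x (Pi.single i 1) = _
      rw [e2]
      rfl
    rw [pd_mul_aux i _ (fun y => pd i ψ y + ψ y * (lam * pd i φ y)) x (dE x) ((dpψ i x).add ((dψ x).mul (dl x))),
      pd_add_aux i _ (fun y => ψ y * (lam * pd i φ y)) x (dpψ i x) ((dψ x).mul (dl x)),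
      pd_mul_aux i _ _ x (dψ x) (dl x), e1, pd_exp_aux i lam φ x (dφ x)]
    ring
  have h3 : ∀ i, pd i (fun y => A y i + pd i φ y) x
      = pd i (fun y => A y i) x + pd i (pd i φ) x :=
    fun i => pd_add_aux i _ _ x (dAi i x) (dpφ i x)
  have key := heig x
  have hl : ∀ g : (Fin n → ℝ) → ℝ, lap g x = ∑ i, pd i (pd i g) x := fun g => rfl
  rw [hl] at key ⊢
  simp only [dot, dvg, grd, h1, h2, h3] at key ⊢
  have hμ : μ * (Real.exp (lam * φ x) * ψ x) = Real.exp (lam * φ x) * (μ * ψ x) := by ring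
  rw [hμ, ← key]
  apply sum_aux
  intro i
  ring
end
end

section
/- Let $\rho : \mathbb{R} \to \mathbb{R}$ be a smooth, $2\pi$-periodic, strictly positive function and let $k \in \mathbb{R}$. Set $I := \int_0^{2\pi} \rho(\xi)^{-1}\,d\xi$ and define $\varphi(\theta) := \dfrac{k\bigl(\theta\, I - 2\pi\int_0^\theta \rho(\xi)^{-1}\,d\xi\bigr)}{I}$ for $\theta \in \mathbb{R}$. Then $\varphi$ is twice continuously differentiable, $2\pi$-periodic, satisfies $\varphi(0) = 0$, and solves the ordinary differential equation $\varphi''(\theta) + \gamma(\theta)\varphi'(\theta) = k\,\gamma(\theta)$ for all $\theta \in \mathbb{R}$, where $\gamma(\theta) := \rho'(\theta)/\rho(\theta)$. (This is the explicit periodic solution in the circle example of Section 6 of the paper, solving the fixed-density problem on $S^1$.) -/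
open Real MeasureTheory

noncomputable section

/-- Explicit periodic solution of `φ'' + γφ' = kγ` on the circle (Section 6 example),
where `γ = ρ'/ρ`. -/
theorem circle_fixed_density_explicit_solution
    (ρ : ℝ → ℝ) (hρ : ContDiff ℝ (⊤ : ℕ∞) ρ) (hper : ∀ θ, ρ (θ + 2 * Real.pi) = ρ θ)
    (hpos : ∀ θ, 0 < ρ θ) (k : ℝ)
    (I : ℝ) (hI : I = ∫ ξ in (0:ℝ)..(2 * Real.pi), (ρ ξ)⁻¹)
    (φ : ℝ → ℝ)
    (hφ : φ = fun θ => k * (θ * I - 2 * Real.pi * ∫ ξ in (0:ℝ)..θ, (ρ ξ)⁻¹) / I) :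
    ContDiff ℝ 2 φ ∧ (∀ θ, φ (θ + 2 * Real.pi) = φ θ) ∧ φ 0 = 0 ∧
    (∀ θ, deriv (deriv φ) θ + (deriv ρ θ / ρ θ) * deriv φ θ
        = k * (deriv ρ θ / ρ θ)) := by
  have hne : ∀ θ, ρ θ ≠ 0 := fun θ => (hpos θ).ne'
  have hinv : ContDiff ℝ (⊤ : ℕ∞) (fun ξ => (ρ ξ)⁻¹) := hρ.inv hne
  have hc : Continuous (fun ξ => (ρ ξ)⁻¹) := hinv.continuous
  have hint : ∀ a b, IntervalIntegrable (fun ξ => (ρ ξ)⁻¹) volume a b :=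
    fun a b => hc.intervalIntegrable a b
  have hIpos : 0 < I := by
    rw [hI]
    exact intervalIntegral.intervalIntegral_pos_of_pos (hint _ _)
      (fun x => inv_pos.mpr (hpos x)) (by positivity)
  have hI0 : I ≠ 0 := hIpos.ne'
  have hd : ∀ θ, HasDerivAt φ (k * (I - 2 * Real.pi * (ρ θ)⁻¹) / I) θ := by
    intro θ
    have h1 : HasDerivAt (fun u => ∫ ξ in (0:ℝ)..u, (ρ ξ)⁻¹) ((ρ θ)⁻¹) θ :=
      intervalIntegral.integral_hasDerivAt_right (hint _ _)
        hc.stronglyMeasurable.stronglyMeasurableAtFilter hc.continuousAt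
    have h2 := ((((hasDerivAt_id θ).mul_const I).sub
      (h1.const_mul (2 * Real.pi))).const_mul k).div_const I
    rw [hφ]
    simpa using h2
  have hdφ : deriv φ = fun θ => k * (I - 2 * Real.pi * (ρ θ)⁻¹) / I :=
    funext fun θ => (hd θ).deriv
  refine ⟨?_, ?_, ?_, ?_⟩
  · have h2 : (2 : WithTop ℕ∞) = 1 + 1 := by norm_num
    rw [h2, contDiff_succ_iff_deriv]
    refine ⟨fun θ => (hd θ).differentiableAt, by simp, ?_⟩
    rw [hdφ]
    have h3 : ContDiff ℝ 1 (fun ξ => (ρ ξ)⁻¹) := hinv.of_le (by exact_mod_cast le_top)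
    exact ((contDiff_const.mul (contDiff_const.sub (contDiff_const.mul h3))).div_const I)
  · intro θ
    have hp : Function.Periodic (fun ξ => (ρ ξ)⁻¹) (2 * Real.pi) := fun x => by
      simp only [hper]
    have h4 : ∫ ξ in (0:ℝ)..(θ + 2 * Real.pi), (ρ ξ)⁻¹ = (∫ ξ in (0:ℝ)..θ, (ρ ξ)⁻¹) + I := by
      rw [← intervalIntegral.integral_add_adjacent_intervals (hint 0 θ) (hint θ _),
        hp.intervalIntegral_add_eq θ 0, zero_add, hI]
    rw [hφ]
    simp only [h4]
    ring
  · rw [hφ]; simp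
  · intro θ
    have hρd : HasDerivAt ρ (deriv ρ θ) θ :=
      (hρ.differentiable (by simp) θ).hasDerivAt
    have h5 : HasDerivAt (fun θ => k * (I - 2 * Real.pi * (ρ θ)⁻¹) / I) _ θ :=
      ((((hρd.fun_inv (hne θ)).const_mul (2 * Real.pi)).const_sub I).const_mul k).div_const I
    rw [hdφ, h5.deriv]
    have := hne θ
    field_simp
    ring
end
end
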